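/- Let (E, {f_i}_{i=1}^m) ∈ 𝓔 with convex hull I. If f_i(I) ∩ f_{i+1}(I) = ∅ for some i ∈ {2,…,m−2}, then dim_H U_1(E) = dim_H (f_i(E) ∩ U_1(E)) = dim_H (f_{i+1}(E) ∩ U_1(E)). -/

import Mathlib

open Set Filter MeasureTheory

/-- A self-similar iterated function system on `ℝ` given by `m` similitudes
`f i x = r i * x + t i` (for `1 ≤ i ≤ m`, `m ≥ 3`), together with its attractor `E`:
the unique nonempty compact set with `E = ⋃_{i=1}^m f_i(E)`. -/
structure ClassE where
  m : ℕ
  r : ℕ → ℝ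
  t : ℕ → ℝ
  E : Set ℝ
  hm : 3 ≤ m
  hr : ∀ i, 1 ≤ i → i ≤ m → 0 < r i ∧ r i < 1
  hEne : E.Nonempty
  hEcpt : IsCompact E
  hEinv : E = ⋃ i ∈ Finset.Icc 1 m, (fun x => r i * x + t i) '' E

namespace ClassE

/-- The `i`-th similitude. -/
def f (S : ClassE) (i : ℕ) (x : ℝ) : ℝ := S.r i * x + S.t i

/-- Left endpoint `a` of the convex hull of `E`. -/
noncomputable def a (S : ClassE) : ℝ := sInf S.E

/-- Right endpoint `b` of the convex hull of `E`. -/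
noncomputable def b (S : ClassE) : ℝ := sSup S.E

/-- The convex hull `I = [a, b]` of `E`. -/
noncomputable def I (S : ClassE) : Set ℝ := Set.Icc S.a S.b

/-- Condition (A): `a = f_1(a) < f_2(a) < ⋯ < f_m(a) < f_m(b) = b`. -/
def condA (S : ClassE) : Prop :=
  S.f 1 S.a = S.a ∧ (∀ i, 1 ≤ i → i < S.m → S.f i S.a < S.f (i + 1) S.a) ∧
    S.f S.m S.a < S.f S.m S.b ∧ S.f S.m S.b = S.b

/-- Condition (B): `f_i(I) ∩ f_{i+2}(I) = ∅` for all `1 ≤ i ≤ m - 2`. -/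
def condB (S : ClassE) : Prop :=
  ∀ i, 1 ≤ i → i + 2 ≤ S.m → S.f i '' S.I ∩ S.f (i + 2) '' S.I = ∅

/-- Condition (C): there are `i, j ∈ {1, …, m-1}` with `f_i(I) ∩ f_{i+1}(I) = ∅` and
`f_j(I) ∩ f_{j+1}(I) ≠ ∅`. -/
def condC (S : ClassE) : Prop :=
  (∃ i, 1 ≤ i ∧ i + 1 ≤ S.m ∧ S.f i '' S.I ∩ S.f (i + 1) '' S.I = ∅) ∧
    (∃ j, 1 ≤ j ∧ j + 1 ≤ S.m ∧ S.f j '' S.I ∩ S.f (j + 1) '' S.I ≠ ∅)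

/-- Condition (D): whenever `f_i(I) ∩ f_{i+1}(I) ≠ ∅` there are `u, v ≥ 1` with
`f_i(I) ∩ f_{i+1}(I) = f_i ∘ f_m^u (I) = f_{i+1} ∘ f_1^v (I)`. -/
def condD (S : ClassE) : Prop :=
  ∀ i, 1 ≤ i → i + 1 ≤ S.m → S.f i '' S.I ∩ S.f (i + 1) '' S.I ≠ ∅ →
    ∃ u v : ℕ, 1 ≤ u ∧ 1 ≤ v ∧
      S.f i '' S.I ∩ S.f (i + 1) '' S.I = (S.f i ∘ (S.f S.m)^[u]) '' S.I ∧
      S.f i '' S.I ∩ S.f (i + 1) '' S.I = (S.f (i + 1) ∘ (S.f 1)^[v]) '' S.I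

/-- Membership in the class `𝓔`: conditions (A)–(D). -/
def goodE (S : ClassE) : Prop := S.condA ∧ S.condB ∧ S.condC ∧ S.condD

/-- `prefixMap d n = f_{d 0} ∘ f_{d 1} ∘ ⋯ ∘ f_{d (n-1)}`. -/
def prefixMap (S : ClassE) (d : ℕ → ℕ) : ℕ → ℝ → ℝ
  | 0 => id
  | n + 1 => S.prefixMap d n ∘ S.f (d n)

/-- `d : ℕ → ℕ` (with digits in `{1, …, m}`) is a coding of `x` if
`x = lim_n f_{d 0} ∘ ⋯ ∘ f_{d (n-1)} (0)`. -/
def isCoding (S : ClassE) (d : ℕ → ℕ) (x : ℝ) : Prop :=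
  (∀ n, 1 ≤ d n ∧ d n ≤ S.m) ∧
    Tendsto (fun n => S.prefixMap d n 0) atTop (nhds x)

/-- The set of codings of `x`. -/
def codings (S : ClassE) (x : ℝ) : Set (ℕ → ℕ) := {d | S.isCoding d x}

/-- `U k E`: the set of points of `E` having exactly `k` distinct codings
(`k` a cardinal; e.g. `k = ℵ₀` for countably infinitely many codings,
`k = 𝔠 = 2^ℵ₀` for a continuum of codings). -/
def U (S : ClassE) (k : Cardinal) : Set ℝ :=
  {x ∈ S.E | Cardinal.mk (S.codings x) = k}

end ClassE

open ClassE

namespace ClassE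

theorem aux_f_mem (S : ClassE) {i : ℕ} (h1 : 1 ≤ i) (h2 : i ≤ S.m) {x : ℝ} (hx : x ∈ S.E) :
    S.f i x ∈ S.E := by
  rw [S.hEinv]
  simp only [mem_iUnion]
  exact ⟨i, Finset.mem_Icc.2 ⟨h1, h2⟩, x, hx, rfl⟩

theorem aux_E_sub (S : ClassE) : S.E ⊆ S.I := fun _ hx =>
  ⟨csInf_le S.hEcpt.bddBelow hx, le_csSup S.hEcpt.bddAbove hx⟩

theorem aux_prefix_mem (S : ClassE) {d : ℕ → ℕ} (hd : ∀ n, 1 ≤ d n ∧ d n ≤ S.m) (n : ℕ) :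
    ∀ x ∈ S.E, S.prefixMap d n x ∈ S.E := by
  induction n with
  | zero => intro x hx; exact hx
  | succ n ih => intro x hx; exact ih _ (S.aux_f_mem (hd n).1 (hd n).2 hx)

theorem aux_rho (S : ClassE) : ∃ ρ : ℝ, 0 < ρ ∧ ρ < 1 ∧ ∀ i, 1 ≤ i → i ≤ S.m → S.r i ≤ ρ := by
  have hm := S.hm
  obtain ⟨j, hj, hmax⟩ := Finset.exists_max_image (Finset.Icc 1 S.m) S.r
    ⟨1, Finset.mem_Icc.2 ⟨le_refl 1, by omega⟩⟩
  rw [Finset.mem_Icc] at hj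
  exact ⟨S.r j, (S.hr j hj.1 hj.2).1, (S.hr j hj.1 hj.2).2,
    fun i h1 h2 => hmax i (Finset.mem_Icc.2 ⟨h1, h2⟩)⟩

theorem aux_prefix_dist (S : ClassE) {d : ℕ → ℕ} (hd : ∀ n, 1 ≤ d n ∧ d n ≤ S.m) {ρ : ℝ}
    (h0 : 0 < ρ) (hρ : ∀ i, 1 ≤ i → i ≤ S.m → S.r i ≤ ρ) (n : ℕ) :
    ∀ x y : ℝ, |S.prefixMap d n x - S.prefixMap d n y| ≤ ρ ^ n * |x - y| := by
  induction n with
  | zero => intro x y; simp [prefixMap]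
  | succ n ih =>
    intro x y
    have h1 := ih (S.f (d n) x) (S.f (d n) y)
    have h2 : |S.f (d n) x - S.f (d n) y| ≤ ρ * |x - y| := by
      have : S.f (d n) x - S.f (d n) y = S.r (d n) * (x - y) := by simp only [f]; ring
      rw [this, abs_mul, abs_of_pos (S.hr _ (hd n).1 (hd n).2).1]
      exact mul_le_mul_of_nonneg_right (hρ _ (hd n).1 (hd n).2) (abs_nonneg _)
    calc |S.prefixMap d (n+1) x - S.prefixMap d (n+1) y| ≤ ρ ^ n * |S.f (d n) x - S.f (d n) y| := h1
      _ ≤ ρ ^ n * (ρ * |x - y|) := mul_le_mul_of_nonneg_left h2 (by positivity)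
      _ = _ := by ring

theorem aux_coding_mem (S : ClassE) {d : ℕ → ℕ} {x : ℝ} (h : S.isCoding d x) : x ∈ S.E := by
  obtain ⟨hd, ht⟩ := h
  obtain ⟨e, he⟩ := S.hEne
  obtain ⟨ρ, h0, h1, hρ⟩ := S.aux_rho
  have hz : Tendsto (fun n => S.prefixMap d n e - S.prefixMap d n 0) atTop (nhds 0) := by
    apply squeeze_zero_norm (a := fun n => ρ ^ n * |e - 0|)
    · intro n; exact S.aux_prefix_dist hd h0 hρ n e 0
    · simpa using (tendsto_pow_atTop_nhds_zero_of_lt_one h0.le h1).mul_const |e - 0|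
  have hl : Tendsto (fun n => S.prefixMap d n e) atTop (nhds x) := by
    have := hz.add ht
    simpa using this
  exact S.hEcpt.isClosed.mem_of_tendsto hl
    (Eventually.of_forall fun n => S.aux_prefix_mem hd n e he)

theorem aux_prefix_succ (S : ClassE) (d : ℕ → ℕ) (n : ℕ) :
    ∀ x, S.prefixMap d (n + 1) x = S.f (d 0) (S.prefixMap (fun k => d (k + 1)) n x) := by
  induction n with
  | zero => intro x; rfl
  | succ n ih => intro x; exact ih (S.f (d (n + 1)) x)

theorem aux_coding_cons (S : ClassE) {d : ℕ → ℕ} {x : ℝ} (h1 : 1 ≤ d 0) (h2 : d 0 ≤ S.m)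
    (h : S.isCoding (fun k => d (k + 1)) x) : S.isCoding d (S.f (d 0) x) := by
  refine ⟨fun n => ?_, ?_⟩
  · cases n with
    | zero => exact ⟨h1, h2⟩
    | succ n => exact h.1 n
  · rw [← tendsto_add_atTop_iff_nat 1]
    simp only [aux_prefix_succ]
    exact (h.2.const_mul (S.r (d 0))).add_const _

theorem aux_coding_tail (S : ClassE) {d : ℕ → ℕ} {x : ℝ} (h : S.isCoding d x) :
    ∃ y, S.isCoding (fun k => d (k + 1)) y ∧ x = S.f (d 0) y := by
  have hr := (S.hr _ (h.1 0).1 (h.1 0).2).1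
  refine ⟨(x - S.t (d 0)) / S.r (d 0), ⟨fun n => h.1 (n + 1), ?_⟩, ?_⟩
  · have := h.2
    rw [← tendsto_add_atTop_iff_nat 1] at this
    simp only [aux_prefix_succ] at this
    have h3 := (this.sub_const (S.t (d 0))).div_const (S.r (d 0))
    refine h3.congr fun n => ?_
    simp only [f]
    field_simp
    ring
  · simp only [f]; field_simp; ring

theorem aux_f_inj (S : ClassE) {i : ℕ} (h1 : 1 ≤ i) (h2 : i ≤ S.m) {x y : ℝ}
    (h : S.f i x = S.f i y) : x = y := by
  have hr := (S.hr i h1 h2).1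
  simp only [f] at h
  exact mul_left_cancel₀ hr.ne' (by linarith)

theorem aux_f_mono (S : ClassE) {i : ℕ} (h1 : 1 ≤ i) (h2 : i ≤ S.m) {x y : ℝ}
    (h : x ≤ y) : S.f i x ≤ S.f i y := by
  have hr := (S.hr i h1 h2).1
  simp only [f]
  nlinarith

theorem aux_mem_U (S : ClassE) (x : ℝ) :
    x ∈ S.U 1 ↔ ∃ d, S.isCoding d x ∧ ∀ e, S.isCoding e x → e = d := by
  constructor
  · rintro ⟨_, h⟩
    rw [Cardinal.mk_set_eq_one_iff] at h
    obtain ⟨d, hd⟩ := h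
    exact ⟨d, show d ∈ S.codings x by rw [hd]; rfl,
      fun e he => by have : e ∈ S.codings x := he
                     rw [hd] at this; exact this⟩
  · rintro ⟨d, hd, hu⟩
    refine ⟨S.aux_coding_mem hd, ?_⟩
    rw [Cardinal.mk_set_eq_one_iff]
    exact ⟨d, Set.ext fun e => ⟨fun he => hu e he, fun he => by
      rw [mem_singleton_iff] at he; subst he; exact hd⟩⟩

theorem aux_ab (S : ClassE) : S.a ≤ S.b := by
  obtain ⟨e, he⟩ := S.hEne
  exact (S.aux_E_sub he).1.trans (S.aux_E_sub he).2

theorem aux_far (S : ClassE) (hS : S.goodE) {k j : ℕ} (hk : 1 ≤ k) (hkj : k + 2 ≤ j)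
    (hj : j ≤ S.m) : S.f k S.b < S.f j S.a := by
  obtain ⟨⟨_, hA, _⟩, hB, _⟩ := hS
  have hab := S.aux_ab
  induction j, hkj using Nat.le_induction with
  | base =>
    by_contra hc
    push Not at hc
    have h1 := hA k hk (by omega)
    have h2 := hA (k + 1) (by omega) (by omega)
    have hr := (S.hr k hk (by omega)).1
    have hmem : S.f (k + 2) S.a ∈ S.f k '' S.I ∩ S.f (k + 2) '' S.I := by
      refine ⟨⟨(S.f (k + 2) S.a - S.t k) / S.r k, ⟨?_, ?_⟩, ?_⟩, S.a, ⟨le_refl _, hab⟩, rfl⟩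
      · rw [le_div_iff₀ hr]
        have h3 : S.f k S.a < S.f (k + 2) S.a := h1.trans h2
        simp only [f] at h3 ⊢
        nlinarith
      · rw [div_le_iff₀ hr]
        simp only [f] at hc ⊢
        nlinarith
      · simp only [f]; field_simp; ring
    rw [hB k hk hj] at hmem
    exact hmem
  | succ j hj' ih => exact (ih (by omega)).trans (hA j (by omega) (by omega))

theorem aux_far_disj (S : ClassE) (hS : S.goodE) {k j : ℕ} (hk : 1 ≤ k) (hkj : k + 2 ≤ j)
    (hj : j ≤ S.m) {x : ℝ} (h1 : x ∈ S.f k '' S.I) (h2 : x ∈ S.f j '' S.I) : False := by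
  obtain ⟨y, hy, rfl⟩ := h1
  obtain ⟨z, hz, hyz⟩ := h2
  have := S.aux_far hS hk hkj hj
  have h3 := S.aux_f_mono hk (by omega) hy.2
  have h4 := S.aux_f_mono (by omega) hj hz.1
  linarith

theorem aux_end (S : ClassE) (hS : S.goodE) {k : ℕ} (hk : k = 1 ∨ k = S.m) :
    ∀ x ∈ S.I, S.f k x ∈ S.I := by
  have hm := S.hm
  have hab := S.aux_ab
  obtain ⟨⟨hA1, hA, _, hA3⟩, _⟩ := id hS
  have h1 := S.aux_far hS (le_refl 1) hm (le_refl _)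
  have h2 : S.f S.m S.a ≤ S.f S.m S.b := S.aux_f_mono (by omega) (le_refl _) hab
  have h3 : S.f 1 S.a ≤ S.f 1 S.b := S.aux_f_mono (le_refl _) (by omega) hab
  have hk' : 1 ≤ k ∧ k ≤ S.m := by omega
  intro x hx
  have h4 := S.aux_f_mono hk'.1 hk'.2 hx.1
  have h5 := S.aux_f_mono hk'.1 hk'.2 hx.2
  rcases hk with rfl | rfl
  · exact ⟨by linarith, by linarith⟩
  · exact ⟨by linarith, by linarith⟩

theorem aux_iter (S : ClassE) (hS : S.goodE) {k : ℕ} (hk : k = 1 ∨ k = S.m) {v : ℕ}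
    (hv : 1 ≤ v) {x : ℝ} (hx : x ∈ S.I) : (S.f k)^[v] x ∈ S.f k '' S.I := by
  obtain ⟨w, rfl⟩ : ∃ w, v = w + 1 := ⟨v - 1, by omega⟩
  rw [Function.iterate_succ_apply']
  refine mem_image_of_mem _ ?_
  clear hv
  induction w with
  | zero => exact hx
  | succ w ih => rw [Function.iterate_succ_apply']; exact S.aux_end hS hk _ ih

/-- If `f_i x` lies in no other piece, then `f_i x` has a unique coding. -/
theorem aux_U (S : ClassE) {i : ℕ} (h1 : 1 ≤ i) (h2 : i ≤ S.m) {x : ℝ} (hx : x ∈ S.U 1)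
    (hne : ∀ j, 1 ≤ j → j ≤ S.m → S.f i x ∈ S.f j '' S.I → j = i) : S.f i x ∈ S.U 1 := by
  rw [aux_mem_U] at hx ⊢
  obtain ⟨d, hd, hu⟩ := hx
  refine ⟨fun n => Nat.casesOn n i d, S.aux_coding_cons (d := fun n => Nat.casesOn n i d) h1 h2 hd,
    fun e he => ?_⟩
  obtain ⟨y, hy, hxy⟩ := S.aux_coding_tail he
  have h0 : e 0 = i := hne _ (he.1 0).1 (he.1 0).2 
    ⟨y, S.aux_E_sub (S.aux_coding_mem hy), hxy.symm⟩
  rw [h0] at hxy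
  have hyx := S.aux_f_inj h1 h2 hxy
  subst hyx
  have := hu _ hy
  funext n
  cases n with
  | zero => exact h0
  | succ n => exact congrFun this n

theorem aux_left (S : ClassE) (hS : S.goodE) (i : ℕ)
    (hi : 2 ≤ i) (him : i + 2 ≤ S.m)
    (h : S.f i '' S.I ∩ S.f (i + 1) '' S.I = ∅) {x : ℝ} (hx : x ∈ S.U 1)
    (hx1 : x ∉ S.f 1 '' S.I) : S.f i x ∈ S.U 1 := by
  have hxI := S.aux_E_sub hx.1
  refine S.aux_U (by omega) (by omega) hx fun j hj1 hj2 hj => ?_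
  have hi' : S.f i x ∈ S.f i '' S.I := mem_image_of_mem _ hxI
  by_contra hne
  rcases Nat.lt_or_ge (j + 1) i with h3 | h3
  · exact S.aux_far_disj hS hj1 h3 (by omega) hj hi'
  rcases Nat.lt_or_ge (i + 1) j with h4 | h4
  · exact S.aux_far_disj hS (by omega) h4 hj2 hi' hj
  rcases (by omega : j = i + 1 ∨ j + 1 = i) with rfl | rfl
  · have : S.f i x ∈ (∅ : Set ℝ) := h ▸ ⟨hi', hj⟩
    exact this
  · have hmem : S.f (j + 1) x ∈ S.f j '' S.I ∩ S.f (j + 1) '' S.I := ⟨hj, hi'⟩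
    obtain ⟨u, v, hu, hv, -, h5⟩ := hS.2.2.2 j hj1 (by omega) (nonempty_iff_ne_empty.1 ⟨_, hmem⟩)
    rw [h5] at hmem
    obtain ⟨w, hw, hwx⟩ := hmem
    have := S.aux_f_inj (by omega) (by omega) hwx
    exact hx1 (this ▸ S.aux_iter hS (Or.inl rfl) hv hw)

theorem aux_right (S : ClassE) (hS : S.goodE) (i : ℕ)
    (hi : 2 ≤ i) (him : i + 2 ≤ S.m)
    (h : S.f i '' S.I ∩ S.f (i + 1) '' S.I = ∅) {x : ℝ} (hx : x ∈ S.U 1)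
    (hx1 : x ∉ S.f S.m '' S.I) : S.f (i + 1) x ∈ S.U 1 := by
  have hxI := S.aux_E_sub hx.1
  refine S.aux_U (by omega) (by omega) hx fun j hj1 hj2 hj => ?_
  have hi' : S.f (i + 1) x ∈ S.f (i + 1) '' S.I := mem_image_of_mem _ hxI
  by_contra hne
  rcases Nat.lt_or_ge (j + 1) (i + 1) with h3 | h3
  · exact S.aux_far_disj hS hj1 h3 (by omega) hj hi'
  rcases Nat.lt_or_ge (i + 2) j with h4 | h4
  · exact S.aux_far_disj hS (by omega) h4 hj2 hi' hj
  rcases (by omega : j = i ∨ j = i + 1 + 1) with rfl | rfl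
  · have : S.f (j + 1) x ∈ (∅ : Set ℝ) := h ▸ ⟨hj, hi'⟩
    exact this
  · have hmem : S.f (i + 1) x ∈ S.f (i + 1) '' S.I ∩ S.f (i + 1 + 1) '' S.I := ⟨hi', hj⟩
    obtain ⟨u, v, hu, hv, h5, -⟩ :=
      hS.2.2.2 (i + 1) (by omega) (by omega) (nonempty_iff_ne_empty.1 ⟨_, hmem⟩)
    rw [h5] at hmem
    obtain ⟨w, hw, hwx⟩ := hmem
    have := S.aux_f_inj (by omega) (by omega) hwx
    exact hx1 (this ▸ S.aux_iter hS (Or.inr rfl) hu hw)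

theorem aux_dim (S : ClassE) {i : ℕ} (h1 : 1 ≤ i) (h2 : i ≤ S.m) (X : Set ℝ) :
    dimH X ≤ dimH (S.f i '' X) := by
  have hr := (S.hr i h1 h2).1
  have hL : LipschitzWith (Real.nnabs (S.r i)⁻¹) (fun x : ℝ => (x - S.t i) * (S.r i)⁻¹) := by
    refine LipschitzWith.of_dist_le_mul fun x y => ?_
    simp only [Real.dist_eq, Real.coe_nnabs]
    rw [← abs_mul]
    apply le_of_eq
    congr 1
    ring
  have := hL.dimH_image_le (S.f i '' X)
  rw [image_image] at this
  convert this
  symm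
  convert image_id X using 2
  simp only [f, id]
  field_simp
  ring

theorem aux_final (S : ClassE) {p q : ℕ} (hp1 : 1 ≤ p) (hp2 : p ≤ S.m) (hq1 : 1 ≤ q)
    (hq2 : q ≤ S.m) (hpq : ∀ x ∈ S.U 1, S.f p x ∈ S.U 1 ∨ S.f p (S.f q x) ∈ S.U 1) :
    dimH (S.U 1) = dimH (S.f p '' S.E ∩ S.U 1) := by
  apply le_antisymm _ (dimH_mono inter_subset_right)
  have hsub : S.U 1 ⊆ {x ∈ S.U 1 | S.f p x ∈ S.U 1} ∪ {x ∈ S.U 1 | S.f p (S.f q x) ∈ S.U 1} := by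
    intro x hx
    rcases hpq x hx with h | h
    · exact Or.inl ⟨hx, h⟩
    · exact Or.inr ⟨hx, h⟩
  refine (dimH_mono hsub).trans ?_
  rw [dimH_union]
  apply max_le
  · refine (S.aux_dim hp1 hp2 _).trans (dimH_mono ?_)
    rintro _ ⟨x, ⟨hx, hx'⟩, rfl⟩
    exact ⟨mem_image_of_mem _ hx.1, hx'⟩
  · refine ((S.aux_dim hq1 hq2 _).trans (S.aux_dim hp1 hp2 _)).trans (dimH_mono ?_)
    rintro _ ⟨_, ⟨x, ⟨hx, hx'⟩, rfl⟩, rfl⟩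
    exact ⟨mem_image_of_mem _ (S.aux_f_mem hq1 hq2 hx.1), hx'⟩

end ClassE

theorem stmt12 (S : ClassE) (hS : S.goodE) (i : ℕ)
    (hi : 2 ≤ i) (him : i + 2 ≤ S.m)
    (h : S.f i '' S.I ∩ S.f (i + 1) '' S.I = ∅) :
    dimH (S.U 1) = dimH (S.f i '' S.E ∩ S.U 1) ∧
      dimH (S.U 1) = dimH (S.f (i + 1) '' S.E ∩ S.U 1) := by
  constructor
  · refine S.aux_final (q := i + 1) (by omega) (by omega) (by omega) (by omega) fun x hx => ?_
    by_cases hx1 : x ∈ S.f 1 '' S.I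
    · right
      refine S.aux_left hS i hi him h (S.aux_right hS i hi him h hx fun hxm => ?_) fun hc => ?_
      · exact S.aux_far_disj hS (le_refl 1) (by omega) (le_refl _) hx1 hxm
      · exact S.aux_far_disj hS (le_refl 1) (by omega) (by omega) hc
          (mem_image_of_mem (S.f (i + 1)) (S.aux_E_sub hx.1))
    · exact Or.inl (S.aux_left hS i hi him h hx hx1)
  · refine S.aux_final (q := i) (by omega) (by omega) (by omega) (by omega) fun x hx => ?_
    by_cases hx1 : x ∈ S.f S.m '' S.I
    · right
      refine S.aux_right hS i hi him h (S.aux_left hS i hi him h hx fun hxm => ?_) fun hc => ?_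
      · exact S.aux_far_disj hS (le_refl 1) (by omega) (le_refl _) hxm hx1
      · exact S.aux_far_disj hS (by omega) him (le_refl _)
          (mem_image_of_mem (S.f i) (S.aux_E_sub hx.1)) hc
    · exact Or.inl (S.aux_right hS i hi him h hx hx1)
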